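/- Let (R,F,μ) be a run-based probability system such that R is synchronous and agents i and j both have perfect recall. Then agent j maintains run-based probabilistic secrecy with respect to i if and only if for all runs r, r', r'' ∈ R and all times m: μ(R(K_j(r'',m)) | R(K_i(r,m))) = μ(R(K_j(r'',m)) | R(K_i(r',m))). (The latter condition is precisely probabilistic synchronous secrecy of j with respect to i in the standard probability system determined by (R,F,μ).) -/

import Mathlib

open MeasureTheory

namespace Paper

variable {G LI LJ : Type*}

/-- The set of points of the system `R`: pairs of a run in `R` and a time. -/
def ptsOf (R : Set (ℕ → G)) : Set ((ℕ → G) × ℕ) := {p | p.1 ∈ R}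

/-- The information set, at the point `p`, of the agent whose local-state projection is `v`. -/
def infoSet {L : Type*} (R : Set (ℕ → G)) (v : (ℕ → G) → ℕ → L) (p : (ℕ → G) × ℕ) :
    Set ((ℕ → G) × ℕ) :=
  {q | q.1 ∈ R ∧ v q.1 q.2 = v p.1 p.2}

/-- `R(U)`: the runs of `R` going through a point of `U`. -/
def runsThrough (R : Set (ℕ → G)) (U : Set ((ℕ → G) × ℕ)) : Set (ℕ → G) :=
  {r | r ∈ R ∧ ∃ m : ℕ, (r, m) ∈ U}

/-- The local-state sequence of the agent with local-state projection `v` at `(r,m)`. -/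
noncomputable def lsSeq {L : Type*} (v : (ℕ → G) → ℕ → L) (r : ℕ → G) (m : ℕ) : List L :=
  letI : DecidableRel fun a b : L => a ≠ b := fun _ _ => Classical.dec _
  ((List.range (m + 1)).map (v r)).destutter (· ≠ ·)

/-- The agent with local-state projection `v` has perfect recall in `R`. -/
def PerfectRecall {L : Type*} (R : Set (ℕ → G)) (v : (ℕ → G) → ℕ → L) : Prop :=
  ∀ p q : (ℕ → G) × ℕ, p ∈ ptsOf R → q ∈ infoSet R v p →
    lsSeq v q.1 q.2 = lsSeq v p.1 p.2

/-- The system is synchronous for the agent with local-state projection `v`. -/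
def Synchronous {L : Type*} (R : Set (ℕ → G)) (v : (ℕ → G) → ℕ → L) : Prop :=
  ∀ r ∈ R, ∀ r' ∈ R, ∀ m m' : ℕ, v r m = v r' m' → m = m'

/-- Agent `j` (local states `vj`) maintains run-based probabilistic secrecy with respect
to agent `i` (local states `vi`) in `(R,F,μ)`. -/
def RunBasedProbSecrecy [MeasurableSpace (ℕ → G)]
    (μ : Measure (ℕ → G)) (R : Set (ℕ → G))
    (vi : (ℕ → G) → ℕ → LI) (vj : (ℕ → G) → ℕ → LJ) : Prop :=
  ∀ p ∈ ptsOf R, ∀ p' ∈ ptsOf R, ∀ q ∈ ptsOf R,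
    μ (runsThrough R (infoSet R vj q) ∩ runsThrough R (infoSet R vi p)) /
        μ (runsThrough R (infoSet R vi p)) =
      μ (runsThrough R (infoSet R vj q) ∩ runsThrough R (infoSet R vi p')) /
        μ (runsThrough R (infoSet R vi p'))

/-- In a synchronous system the runs through an information set at time `m` are those
with the same local state at time `m`. -/
theorem mem_runsThrough_infoSet {L : Type*} {R : Set (ℕ → G)} {v : (ℕ → G) → ℕ → L}
    (hs : Synchronous R v) {r r' : ℕ → G} {m : ℕ} (hr : r ∈ R) :
    r' ∈ runsThrough R (infoSet R v (r, m)) ↔ r' ∈ R ∧ v r' m = v r m := by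
  constructor
  · rintro ⟨h, k, -, hk⟩
    obtain rfl : k = m := hs r' h r hr k m hk
    exact ⟨h, hk⟩
  · rintro ⟨h, hk⟩
    exact ⟨h, m, h, hk⟩

theorem lsSeq_eq_map_range {L : Type*} {R : Set (ℕ → G)} {v : (ℕ → G) → ℕ → L}
    (hs : Synchronous R v) {r : ℕ → G} (hr : r ∈ R) (m : ℕ) :
    lsSeq v r m = (List.range (m + 1)).map (v r) := by
  unfold lsSeq
  refine @List.destutter_of_isChain L (· ≠ ·) (fun _ _ => Classical.dec _) _ ?_
  apply List.Pairwise.isChain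
  exact List.Nodup.map (fun a b h => hs r hr r hr a b h) List.nodup_range

theorem PerfectRecall.eq_of_le {L : Type*} {R : Set (ℕ → G)} {v : (ℕ → G) → ℕ → L}
    (hp : PerfectRecall R v) (hs : Synchronous R v) {r r' : ℕ → G} {k m : ℕ}
    (hr : r ∈ R) (hr' : r' ∈ R) (hkm : k ≤ m) (h : v r' m = v r m) : v r' k = v r k := by
  have := hp (r, m) (r', m) hr ⟨hr', h⟩
  rw [lsSeq_eq_map_range hs hr', lsSeq_eq_map_range hs hr] at this
  exact List.map_inj_left.1 this k (List.mem_range.2 (by omega))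

/-- With perfect recall, information sets refine over time. -/
theorem runsThrough_infoSet_subset {L : Type*} {R : Set (ℕ → G)} {v : (ℕ → G) → ℕ → L}
    (hp : PerfectRecall R v) (hs : Synchronous R v) {r r' : ℕ → G} {k m : ℕ}
    (hr : r ∈ R) (hr' : r' ∈ runsThrough R (infoSet R v (r, k))) (hkm : k ≤ m) :
    runsThrough R (infoSet R v (r', m)) ⊆ runsThrough R (infoSet R v (r, k)) := by
  intro x hx
  rw [mem_runsThrough_infoSet hs hr] at hr' ⊢
  rw [mem_runsThrough_infoSet hs hr'.1] at hx
  exact ⟨hx.1, (hp.eq_of_le hs hr'.1 hx.1 hkm hx.2).trans hr'.2⟩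

/-- A constant conditional probability of `B` given the information sets at time `m`
is also the conditional probability given any union of such sets. -/
theorem measure_inter_eq_mul_of_saturated {L : Type*} {R : Set (ℕ → G)}
    {v : (ℕ → G) → ℕ → L} (hs : Synchronous R v)
    [MeasurableSpace (ℕ → G)] (μ : Measure (ℕ → G)) [IsFiniteMeasure μ]
    (hmeas : ∀ p ∈ ptsOf R, MeasurableSet (runsThrough R (infoSet R v p)) ∧
      0 < μ (runsThrough R (infoSet R v p)))
    {D B : Set (ℕ → G)} {m : ℕ} {c : ENNReal} (hDR : D ⊆ R)
    (hD : ∀ r ∈ D, runsThrough R (infoSet R v (r, m)) ⊆ D)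
    (hB : ∀ r ∈ D, μ (runsThrough R (infoSet R v (r, m)) ∩ B) =
      c * μ (runsThrough R (infoSet R v (r, m)))) :
    μ (D ∩ B) = c * μ D := by
  set S : Set (Set (ℕ → G)) := (fun r => runsThrough R (infoSet R v (r, m))) '' D with hS
  have hmS : ∀ s ∈ S, MeasurableSet s := by
    rintro _ ⟨r, hr, rfl⟩
    exact (hmeas (r, m) (hDR hr)).1
  have hdisj : S.PairwiseDisjoint id := by
    rintro _ ⟨r, hr, rfl⟩ _ ⟨r', hr', rfl⟩ hne
    refine Set.disjoint_left.2 fun x hx hx' => hne ?_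
    simp only [id, mem_runsThrough_infoSet hs (hDR hr),
      mem_runsThrough_infoSet hs (hDR hr')] at hx hx'
    ext y
    simp only [mem_runsThrough_infoSet hs (hDR hr), mem_runsThrough_infoSet hs (hDR hr'),
      ← hx.2, ← hx'.2]
  have hcount : S.Countable := by
    have := Measure.countable_meas_pos_of_disjoint_iUnion (μ := μ)
      (As := fun s : S => (s : Set (ℕ → G))) (fun s => hmS s s.2)
      (fun s t hst => hdisj s.2 t.2 (fun h => hst (Subtype.ext h)))
    have huniv : {s : S | 0 < μ (s : Set (ℕ → G))} = Set.univ := by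
      refine Set.eq_univ_of_forall ?_
      rintro ⟨_, r, hr, rfl⟩
      exact (hmeas (r, m) (hDR hr)).2
    rw [huniv] at this
    exact Set.countable_coe_iff.1 (Set.countable_univ_iff.1 this)
  have hDS : D = ⋃₀ S := by
    refine Set.Subset.antisymm (fun r hr => ⟨_, ⟨r, hr, rfl⟩, ?_⟩) ?_
    · exact (mem_runsThrough_infoSet hs (hDR hr)).2 ⟨hDR hr, rfl⟩
    · rintro x ⟨_, ⟨r, hr, rfl⟩, hx⟩
      exact hD r hr hx
  have hDm : MeasurableSet D := hDS ▸ MeasurableSet.sUnion hcount hmS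
  rw [← Measure.restrict_apply hDm, hDS, measure_sUnion hcount hdisj hmS,
    measure_sUnion hcount hdisj hmS, ← ENNReal.tsum_mul_left]
  refine tsum_congr ?_
  rintro ⟨_, r, hr, rfl⟩
  rw [Measure.restrict_apply (hmeas (r, m) (hDR hr)).1]
  exact hB r hr

/-- in a synchronous run-based probability system in which both agents have
perfect recall, run-based probabilistic secrecy of `j` with respect to `i` is equivalent
to probabilistic synchronous secrecy of `j` with respect to `i` in the determined
standard probability system, i.e. to the condition that for all runs `r, r', r''` and all
times `m`, `μ(R(K_j(r'',m)) | R(K_i(r,m))) = μ(R(K_j(r'',m)) | R(K_i(r',m)))`. -/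
theorem runBasedProbSecrecy_iff_syncProbSecrecy (R : Set (ℕ → G)) (hR : R.Nonempty)
    (vi : (ℕ → G) → ℕ → LI) (vj : (ℕ → G) → ℕ → LJ)
    (hsynci : Synchronous R vi) (hsyncj : Synchronous R vj)
    (hpri : PerfectRecall R vi) (hprj : PerfectRecall R vj)
    [MeasurableSpace (ℕ → G)] (μ : Measure (ℕ → G)) [IsProbabilityMeasure μ]
    (hfull : μ R = 1)
    (hmeasI : ∀ p ∈ ptsOf R, MeasurableSet (runsThrough R (infoSet R vi p)) ∧
      0 < μ (runsThrough R (infoSet R vi p)))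
    (hmeasJ : ∀ p ∈ ptsOf R, MeasurableSet (runsThrough R (infoSet R vj p)) ∧
      0 < μ (runsThrough R (infoSet R vj p))) :
    RunBasedProbSecrecy μ R vi vj ↔
      ∀ r ∈ R, ∀ r' ∈ R, ∀ r'' ∈ R, ∀ m : ℕ,
        μ (runsThrough R (infoSet R vj (r'', m)) ∩ runsThrough R (infoSet R vi (r, m))) /
            μ (runsThrough R (infoSet R vi (r, m))) =
          μ (runsThrough R (infoSet R vj (r'', m)) ∩
              runsThrough R (infoSet R vi (r', m))) /
            μ (runsThrough R (infoSet R vi (r', m))) := by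
  constructor
  · intro h r hr r' hr' r'' hr'' m
    exact h (r, m) hr (r', m) hr' (r'', m) hr''
  intro h
  have hsync : ∀ m, ∀ r ∈ R, ∀ s ∈ R,
      μ (runsThrough R (infoSet R vi (r, m)) ∩ runsThrough R (infoSet R vj (s, m))) =
        μ (runsThrough R (infoSet R vj (s, m))) *
          μ (runsThrough R (infoSet R vi (r, m))) := by
    intro m r hr s hs
    have key : ∀ x ∈ R,
        μ (runsThrough R (infoSet R vi (x, m)) ∩ runsThrough R (infoSet R vj (s, m))) =
          μ (runsThrough R (infoSet R vj (s, m)) ∩ runsThrough R (infoSet R vi (r, m))) /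
            μ (runsThrough R (infoSet R vi (r, m))) *
              μ (runsThrough R (infoSet R vi (x, m))) := by
      intro x hx
      rw [h r hr x hx s hs m, ENNReal.div_mul_cancel (hmeasI (x, m) hx).2.ne'
        (measure_ne_top μ _), Set.inter_comm]
    have htotal := measure_inter_eq_mul_of_saturated hsynci μ hmeasI subset_rfl
      (fun _ _ _ hx => hx.1) key
    rw [hfull, mul_one, Set.inter_eq_right.2 fun _ hx => hx.1] at htotal
    rw [htotal]
    exact key r hr
  have hindep : ∀ p ∈ ptsOf R, ∀ q ∈ ptsOf R,
      μ (runsThrough R (infoSet R vj q) ∩ runsThrough R (infoSet R vi p)) =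
        μ (runsThrough R (infoSet R vj q)) * μ (runsThrough R (infoSet R vi p)) := by
    rintro ⟨r, m⟩ hr ⟨s, n⟩ hs
    rcases le_total n m with hnm | hmn
    · rw [mul_comm]
      refine measure_inter_eq_mul_of_saturated hsyncj μ hmeasJ (m := m)
        (fun _ hx => hx.1)
        (fun x hx => runsThrough_infoSet_subset hprj hsyncj hs hx hnm) fun x hx => ?_
      rw [Set.inter_comm, mul_comm]
      exact hsync m r hr x hx.1
    · rw [Set.inter_comm]
      exact measure_inter_eq_mul_of_saturated hsynci μ hmeasI (m := n)
        (fun _ hx => hx.1)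
        (fun x hx => runsThrough_infoSet_subset hpri hsynci hr hx hmn)
        fun x hx => hsync n x hx.1 s hs
  intro p hp p' hp' q hq
  rw [hindep p hp q hq, hindep p' hp' q hq,
    ENNReal.mul_div_cancel_right (hmeasI p hp).2.ne' (measure_ne_top μ _),
    ENNReal.mul_div_cancel_right (hmeasI p' hp').2.ne' (measure_ne_top μ _)]

end Paper
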